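/- Let X be a finitely generated Banach C(K)-module with m injective and m(C(K)) weak-operator closed, K hyperstonian, m (weak-star, weak-operator) continuous, and the Boolean algebra of idempotents Bade complete on X. If no cyclic subspace of X contains a closed subspace isomorphic to ℓ∞, then X itself contains no closed subspace isomorphic to ℓ∞. -/

import Mathlib

open Filter Topology

/-- A Banach space `E` contains a copy of `ℓ∞` if there is a continuous linear embedding
of `ℓ∞` into `E` which is bounded below (hence an isomorphism onto its closed range). -/
def ContainsLinfty (E : Type*) [NormedAddCommGroup E] [NormedSpace ℝ E] : Prop :=
  ∃ T : lp (fun _ : ℕ => ℝ) ⊤ →L[ℝ] E, ∃ c > (0 : ℝ),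
    ∀ f : lp (fun _ : ℕ => ℝ) ⊤, c * ‖f‖ ≤ ‖T f‖

/-- A bounded functional on `C(K)` is order continuous. -/
def OrderContinuousFunc {K : Type*} [TopologicalSpace K] [CompactSpace K] [T2Space K]
    (φ : C(K, ℝ) →L[ℝ] ℝ) : Prop :=
  ∀ S : Set C(K, ℝ), S.Nonempty → DirectedOn (· ≤ ·) S → ∀ b : C(K, ℝ), IsLUB S b →
    Filter.Tendsto (fun a : S => φ (a : C(K, ℝ))) Filter.atTop (nhds (φ b))

/-- `K` is hyperstonian: the order continuous functionals on `C(K)` separate points. -/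
def SeparatesByNormalFunctionals (K : Type*) [TopologicalSpace K] [CompactSpace K]
    [T2Space K] : Prop :=
  ∀ a : C(K, ℝ), a ≠ 0 → ∃ φ : C(K, ℝ) →L[ℝ] ℝ, OrderContinuousFunc φ ∧ φ a ≠ 0

/-- `m` is (weak-star, weak-operator) continuous, stated via nets. -/
def WStarWOTContinuous {K X : Type*} [TopologicalSpace K] [CompactSpace K] [T2Space K]
    [NormedAddCommGroup X] [NormedSpace ℝ X] [CompleteSpace X]
    (m : C(K, ℝ) →ₐ[ℝ] (X →L[ℝ] X)) : Prop :=
  ∀ (ι : Type) (_ : Preorder ι) (f : ι → C(K, ℝ)) (a : C(K, ℝ)),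
    (∀ φ : C(K, ℝ) →L[ℝ] ℝ, OrderContinuousFunc φ →
      Filter.Tendsto (fun i => φ (f i)) Filter.atTop (nhds (φ a))) →
    ∀ (x : X) (x' : X →L[ℝ] ℝ),
      Filter.Tendsto (fun i => x' (m (f i) x)) Filter.atTop (nhds (x' (m a x)))

/-- The Boolean algebra of idempotents of `C(K)` is Bade complete on `X`. -/
def BadeComplete {K X : Type*} [TopologicalSpace K] [CompactSpace K] [T2Space K]
    [NormedAddCommGroup X] [NormedSpace ℝ X] [CompleteSpace X]
    (m : C(K, ℝ) →ₐ[ℝ] (X →L[ℝ] X)) : Prop :=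
  ∀ S : Set C(K, ℝ), (∀ e ∈ S, e * e = e) → S.Nonempty → DirectedOn (· ≤ ·) S →
    ∀ E : C(K, ℝ), E * E = E → IsLUB S E →
      ∀ x : X, Filter.Tendsto (fun e : S => m (e : C(K, ℝ)) x) Filter.atTop (nhds (m E x))

section Modulus

variable {K : Type*} [TopologicalSpace K]

/-- The modulus `|φ|` of a bounded functional on `C(K)`, evaluated on the positive cone. -/
noncomputable def modulus (φ : C(K, ℝ) →L[ℝ] ℝ) (a : C(K, ℝ)) : ℝ :=
  sSup (φ '' {b | |b| ≤ a})

lemma modulus_le (φ : C(K, ℝ) →L[ℝ] ℝ) {a : C(K, ℝ)} (ha : 0 ≤ a) {r : ℝ}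
    (h : ∀ b, |b| ≤ a → φ b ≤ r) : modulus φ a ≤ r := by
  refine csSup_le ⟨φ 0, 0, by simpa using ha, rfl⟩ ?_
  rintro _ ⟨b, hb, rfl⟩
  exact h b hb

variable [CompactSpace K]

lemma ContinuousMap.norm_le_norm_of_abs_le {a b : C(K, ℝ)} (h : |b| ≤ a) : ‖b‖ ≤ ‖a‖ := by
  refine (ContinuousMap.norm_le _ (norm_nonneg _)).2 fun x => ?_
  have h1 : |b x| ≤ a x := h x
  exact h1.trans ((le_abs_self _).trans (a.norm_coe_le_norm x))

lemma bddAbove_modulus (φ : C(K, ℝ) →L[ℝ] ℝ) (a : C(K, ℝ)) :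
    BddAbove (φ '' {b | |b| ≤ a}) := by
  refine ⟨‖φ‖ * ‖a‖, ?_⟩
  rintro _ ⟨b, hb, rfl⟩
  refine (le_abs_self _).trans ((φ.le_opNorm b).trans ?_)
  gcongr
  exact ContinuousMap.norm_le_norm_of_abs_le hb

lemma le_modulus (φ : C(K, ℝ) →L[ℝ] ℝ) {a b : C(K, ℝ)} (h : |b| ≤ a) : φ b ≤ modulus φ a :=
  le_csSup (bddAbove_modulus φ a) ⟨b, h, rfl⟩

lemma abs_le_modulus (φ : C(K, ℝ) →L[ℝ] ℝ) {a b : C(K, ℝ)} (h : |b| ≤ a) :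
    |φ b| ≤ modulus φ a := by
  refine abs_le'.2 ⟨le_modulus φ h, ?_⟩
  rw [← map_neg]
  exact le_modulus φ (by rwa [abs_neg])

lemma modulus_nonneg (φ : C(K, ℝ) →L[ℝ] ℝ) {a : C(K, ℝ)} (ha : 0 ≤ a) : 0 ≤ modulus φ a := by
  simpa using le_modulus φ (b := 0) (by simpa using ha)

lemma modulus_le_norm (φ : C(K, ℝ) →L[ℝ] ℝ) {a : C(K, ℝ)} (ha : 0 ≤ a) :
    modulus φ a ≤ ‖φ‖ * ‖a‖ := by
  refine modulus_le φ ha fun b hb => (le_abs_self _).trans ((φ.le_opNorm b).trans ?_)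
  gcongr
  exact ContinuousMap.norm_le_norm_of_abs_le hb

lemma modulus_mono (φ : C(K, ℝ) →L[ℝ] ℝ) {a b : C(K, ℝ)} (ha : 0 ≤ a) (h : a ≤ b) :
    modulus φ a ≤ modulus φ b :=
  modulus_le φ ha fun _ hc => le_modulus φ (hc.trans h)

lemma modulus_add (φ : C(K, ℝ) →L[ℝ] ℝ) {a b : C(K, ℝ)} (ha : 0 ≤ a) (hb : 0 ≤ b) :
    modulus φ (a + b) = modulus φ a + modulus φ b := by
  apply le_antisymm
  · refine modulus_le φ (add_nonneg ha hb) fun c hc => ?_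
    set c₁ : C(K, ℝ) := (-a) ⊔ (a ⊓ c) with hc₁
    have h1 : |c₁| ≤ a := by
      intro x
      have : 0 ≤ a x := ha x
      change |(-a x) ⊔ (a x ⊓ c x)| ≤ a x
      grind
    have h2 : |c - c₁| ≤ b := by
      intro x
      have h3 : 0 ≤ a x := ha x
      have h4 : 0 ≤ b x := hb x
      have h5 : |c x| ≤ a x + b x := hc x
      change |c x - (-a x) ⊔ (a x ⊓ c x)| ≤ b x
      grind
    have h3 : φ c = φ c₁ + φ (c - c₁) := by rw [← map_add]; simp
    rw [h3]
    exact add_le_add (le_modulus φ h1) (le_modulus φ h2)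
  · rw [← le_sub_iff_add_le]
    refine modulus_le φ ha fun c hc => ?_
    rw [le_sub_iff_add_le, ← le_sub_iff_add_le']
    refine modulus_le φ hb fun d hd => ?_
    rw [le_sub_iff_add_le', ← map_add]
    exact le_modulus φ ((abs_add_le c d).trans (add_le_add hc hd))

lemma mul_modulus_le (φ : C(K, ℝ) →L[ℝ] ℝ) {a : C(K, ℝ)} (ha : 0 ≤ a) {t : ℝ} (ht : 0 < t) :
    t * modulus φ a ≤ modulus φ (t • a) := by
  rw [mul_comm, ← le_div_iff₀ ht]
  refine modulus_le φ ha fun b hb => ?_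
  rw [le_div_iff₀ ht, mul_comm, ← smul_eq_mul, ← map_smul]
  refine le_modulus φ fun x => ?_
  change |t * b x| ≤ t * a x
  rw [abs_mul, abs_of_pos ht]
  exact mul_le_mul_of_nonneg_left (hb x) ht.le

end Modulus

section Parallelogram

/-- A bounded sequence for a quadratic form has convex combinations of its tails which form a
Cauchy sequence for this form. -/
lemma exists_convexHull_cauchy {V : Type*} [AddCommGroup V] [Module ℝ V] (Q : V → ℝ)
    (hQ0 : ∀ x, 0 ≤ Q x) (hQ4 : ∀ x, Q (x + x) = 4 * Q x)
    (hQ : ∀ x y, Q (x + y) + Q (x - y) = 2 * Q x + 2 * Q y)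
    (d : ℕ → V) (M : ℝ) (hM : ∀ k, Q (d k) ≤ M) :
    ∃ c : ℕ → V, (∀ k, c k ∈ convexHull ℝ (d '' Set.Ici k)) ∧
      ∀ ε > 0, ∃ N, ∀ k ≥ N, ∀ l ≥ N, Q (c k - c l) < ε := by
  set C : ℕ → Set V := fun k => convexHull ℝ (d '' Set.Ici k) with hC
  have hCd : ∀ k, d k ∈ C k := fun k =>
    subset_convexHull ℝ _ ⟨k, Set.self_mem_Ici, rfl⟩
  have hCanti : ∀ {k l}, k ≤ l → C l ⊆ C k := fun h =>
    convexHull_mono (Set.image_mono (Set.Ici_subset_Ici.2 h))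
  have hbdd : ∀ k, BddBelow (Q '' C k) := fun k => ⟨0, by rintro _ ⟨x, -, rfl⟩; exact hQ0 x⟩
  set r : ℕ → ℝ := fun k => sInf (Q '' C k) with hr
  have hrle : ∀ {k x}, x ∈ C k → r k ≤ Q x := fun {k x} hx => csInf_le (hbdd k) ⟨x, hx, rfl⟩
  have hrmono : Monotone r := fun k l h =>
    csInf_le_csInf (hbdd k) ⟨_, d l, hCd l, rfl⟩ (Set.image_mono (hCanti h))
  have hrM : BddAbove (Set.range r) := ⟨M, by
    rintro _ ⟨k, rfl⟩
    exact (hrle (hCd k)).trans (hM k)⟩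
  have hex : ∀ k : ℕ, ∃ x ∈ C k, Q x < r k + 1 / ((k : ℝ) + 1) := fun k => by
    obtain ⟨_, ⟨x, hx, rfl⟩, h⟩ := exists_lt_of_csInf_lt (s := Q '' C k) ⟨_, d k, hCd k, rfl⟩
      (lt_add_of_pos_right (r k) (Nat.one_div_pos_of_nat (α := ℝ) (n := k)))
    exact ⟨x, hx, h⟩
  choose c hcC hcQ using hex
  refine ⟨c, hcC, fun ε hε => ?_⟩
  obtain ⟨N₁, hN₁⟩ := Metric.cauchySeq_iff.1
    (tendsto_atTop_ciSup hrmono hrM).cauchySeq (ε / 8) (by positivity)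
  obtain ⟨N₂, hN₂⟩ := exists_nat_one_div_lt (K := ℝ) (ε := ε / 8) (by positivity)
  have key : ∀ k ≥ max N₁ N₂, ∀ l ≥ k, Q (c k - c l) < ε := by
    intro k hk l hl
    have hkl : (1 / 2 : ℝ) • c k + (1 / 2 : ℝ) • c l ∈ C k :=
      convex_convexHull ℝ _ (hcC k) (hCanti hl (hcC l)) (by norm_num) (by norm_num) (by norm_num)
    have h1 := hrle hkl
    have h2 := hQ4 ((1 / 2 : ℝ) • c k + (1 / 2 : ℝ) • c l)
    have h3 : (1 / 2 : ℝ) • c k + (1 / 2 : ℝ) • c l + ((1 / 2 : ℝ) • c k + (1 / 2 : ℝ) • c l)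
        = c k + c l := by module
    rw [h3] at h2
    have h4 := hQ (c k) (c l)
    have h5 := hN₁ k ((le_max_left _ _).trans hk) l ((le_max_left _ _).trans (hk.trans hl))
    rw [Real.dist_eq] at h5
    have h6 := abs_lt.1 h5
    have h7 : ∀ j ≥ N₂, 1 / ((j : ℝ) + 1) < ε / 8 := fun j hj =>
      (Nat.one_div_le_one_div (α := ℝ) hj).trans_lt hN₂
    have h8 := h7 k ((le_max_right _ _).trans hk)
    have h9 := h7 l ((le_max_right _ _).trans (hk.trans hl))
    have h10 := hcQ k
    have h11 := hcQ l
    linarith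
  have hsymm : ∀ x y, Q (x - y) = Q (y - x) := fun x y => by
    have h1 := hQ x y
    have h2 := hQ y x
    rw [add_comm y x] at h2
    linarith
  refine ⟨max N₁ N₂, fun k hk l hl => ?_⟩
  rcases le_total k l with h | h
  · exact key k hk l h
  · rw [hsymm]
    exact key l hl k h

end Parallelogram

section Clopens

open TopologicalSpace

variable {K : Type*} [TopologicalSpace K]

/-- The continuous indicator function of a clopen set. -/
noncomputable def clopenIndicator (U : Clopens K) : C(K, ℝ) where
  toFun := (U : Set K).indicator 1
  continuous_toFun := U.isClopen.continuous_indicator continuous_const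

lemma clopenIndicator_of_mem {U : Clopens K} {x : K} (h : x ∈ U) : clopenIndicator U x = 1 :=
  Set.indicator_of_mem (s := (U : Set K)) h _

lemma clopenIndicator_of_notMem {U : Clopens K} {x : K} (h : x ∉ U) : clopenIndicator U x = 0 :=
  Set.indicator_of_notMem (s := (U : Set K)) h _

lemma clopenIndicator_nonneg (U : Clopens K) : 0 ≤ clopenIndicator U := fun x => by
  by_cases h : x ∈ U <;> simp [clopenIndicator_of_mem, clopenIndicator_of_notMem, h]

lemma clopenIndicator_mono {U V : Clopens K} (h : U ≤ V) :
    clopenIndicator U ≤ clopenIndicator V := ContinuousMap.le_def.2 fun x => by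
  by_cases hx : x ∈ U
  · rw [clopenIndicator_of_mem hx, clopenIndicator_of_mem (h hx)]
  · rw [clopenIndicator_of_notMem hx]
    exact clopenIndicator_nonneg V x

lemma clopenIndicator_mul_of_le {U V : Clopens K} (h : U ≤ V) :
    clopenIndicator U * clopenIndicator V = clopenIndicator U := by
  ext x
  by_cases hx : x ∈ U
  · simp [clopenIndicator_of_mem hx, clopenIndicator_of_mem (h hx)]
  · simp [clopenIndicator_of_notMem hx]

lemma clopenIndicator_compl (U : Clopens K) : clopenIndicator Uᶜ = 1 - clopenIndicator U := by
  ext x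
  by_cases hx : x ∈ U
  · have : x ∉ Uᶜ := fun h => h hx
    simp [clopenIndicator_of_mem hx, clopenIndicator_of_notMem this]
  · have : x ∈ Uᶜ := hx
    simp [clopenIndicator_of_notMem hx, clopenIndicator_of_mem this]

lemma clopenIndicator_sup_le (U V : Clopens K) :
    clopenIndicator (U ⊔ V) ≤ clopenIndicator U + clopenIndicator V := ContinuousMap.le_def.2 fun x => by
  have hU : 0 ≤ clopenIndicator U x := clopenIndicator_nonneg U x
  have hV : 0 ≤ clopenIndicator V x := clopenIndicator_nonneg V x
  rw [ContinuousMap.add_apply]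
  by_cases hx : x ∈ U ⊔ V
  · rw [clopenIndicator_of_mem hx]
    rcases hx with h | h
    · rw [clopenIndicator_of_mem h]; linarith
    · rw [clopenIndicator_of_mem (U := V) h]; linarith
  · rw [clopenIndicator_of_notMem hx]; positivity

variable [ExtremallyDisconnected K]

/-- The supremum of a sequence of clopen sets of an extremally disconnected space. -/
def clopenSup (V : ℕ → Clopens K) : Clopens K where
  carrier := closure (⋃ k, (V k : Set K))
  isClopen' := ⟨isClosed_closure,
    ExtremallyDisconnected.open_closure _ (isOpen_iUnion fun k => (V k).isOpen)⟩

lemma le_clopenSup (V : ℕ → Clopens K) (k : ℕ) : V k ≤ clopenSup V := fun _ hx =>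
  subset_closure (Set.mem_iUnion.2 ⟨k, hx⟩)

lemma clopenSup_le {V : ℕ → Clopens K} {W : Clopens K} (h : ∀ k, V k ≤ W) : clopenSup V ≤ W :=
  closure_minimal (Set.iUnion_subset h) W.isClosed

lemma isLUB_clopenIndicator (V : ℕ → Clopens K) :
    IsLUB (Set.range fun k => clopenIndicator (V k)) (clopenIndicator (clopenSup V)) := by
  constructor
  · rintro _ ⟨k, rfl⟩
    exact clopenIndicator_mono (le_clopenSup V k)
  · refine fun f hf => ContinuousMap.le_def.2 fun x => ?_
    have hf' : ∀ k, clopenIndicator (V k) ≤ f := fun k => hf ⟨k, rfl⟩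
    by_cases hx : x ∈ clopenSup V
    · rw [clopenIndicator_of_mem hx]
      have : closure (⋃ k, (V k : Set K)) ⊆ {y | 1 ≤ f y} := by
        refine closure_minimal (Set.iUnion_subset fun k y hy => ?_)
          (isClosed_le continuous_const f.continuous)
        have := ContinuousMap.le_def.1 (hf' k) y
        rwa [clopenIndicator_of_mem hy] at this
      exact this hx
    · rw [clopenIndicator_of_notMem hx]
      exact (clopenIndicator_nonneg (V 0) x).trans (hf' 0 x)

end Clopens

lemma BadeComplete.tendsto_clopenIndicator {K X : Type*} [TopologicalSpace K] [CompactSpace K]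
    [T2Space K] [ExtremallyDisconnected K]
    [NormedAddCommGroup X] [NormedSpace ℝ X] [CompleteSpace X]
    {m : C(K, ℝ) →ₐ[ℝ] (X →L[ℝ] X)} (hBade : BadeComplete m)
    {V : ℕ → TopologicalSpace.Clopens K} (hV : Monotone V) (x : X) :
    Tendsto (fun k => m (clopenIndicator (V k)) x) atTop
      (𝓝 (m (clopenIndicator (clopenSup V)) x)) := by
  have hmono : Monotone fun k => clopenIndicator (V k) := fun _ _ h =>
    clopenIndicator_mono (hV h)
  have h := hBade (Set.range fun k => clopenIndicator (V k))
    (by rintro _ ⟨k, rfl⟩; exact clopenIndicator_mul_of_le le_rfl)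
    (Set.range_nonempty _) hmono.directed_le.directedOn_range
    _ (clopenIndicator_mul_of_le le_rfl) (isLUB_clopenIndicator V) x
  have hk : Tendsto (fun k => (⟨clopenIndicator (V k), k, rfl⟩ :
      Set.range fun k => clopenIndicator (V k))) atTop atTop := by
    refine tendsto_atTop.2 ?_
    rintro ⟨_, j, rfl⟩
    filter_upwards [eventually_ge_atTop j] with k hk
    exact hmono hk
  exact h.comp hk

section WeightedModulus

variable {K : Type*} [TopologicalSpace K] [CompactSpace K] {ψ : ℕ → C(K, ℝ) →L[ℝ] ℝ} {M : ℝ}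

/-- The weighted sum of the moduli of a sequence of functionals on `C(K)`. -/
noncomputable def weightedModulus (ψ : ℕ → C(K, ℝ) →L[ℝ] ℝ) (a : C(K, ℝ)) : ℝ :=
  ∑' n, (1 / 2 : ℝ) ^ n * modulus (ψ n) a

lemma summable_weightedModulus (hψ : ∀ n, ‖ψ n‖ ≤ M) {a : C(K, ℝ)} (ha : 0 ≤ a) :
    Summable fun n => (1 / 2 : ℝ) ^ n * modulus (ψ n) a := by
  refine Summable.of_nonneg_of_le (fun n => mul_nonneg (by positivity) (modulus_nonneg _ ha))
    (fun n => ?_) (summable_geometric_two.mul_right (M * ‖a‖))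
  gcongr
  exact (modulus_le_norm _ ha).trans (mul_le_mul_of_nonneg_right (hψ n) (norm_nonneg _))

lemma weightedModulus_nonneg {a : C(K, ℝ)} (ha : 0 ≤ a) : 0 ≤ weightedModulus ψ a :=
  tsum_nonneg fun _ => mul_nonneg (by positivity) (modulus_nonneg _ ha)

lemma weightedModulus_add (hψ : ∀ n, ‖ψ n‖ ≤ M) {a b : C(K, ℝ)} (ha : 0 ≤ a) (hb : 0 ≤ b) :
    weightedModulus ψ (a + b) = weightedModulus ψ a + weightedModulus ψ b := by
  unfold weightedModulus
  rw [← (summable_weightedModulus hψ ha).tsum_add (summable_weightedModulus hψ hb)]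
  congr 1 with n
  rw [modulus_add _ ha hb, mul_add]

lemma weightedModulus_le (hψ : ∀ n, ‖ψ n‖ ≤ M) {a : C(K, ℝ)} (ha : 0 ≤ a) :
    weightedModulus ψ a ≤ 2 * (M * ‖a‖) := by
  rw [← tsum_geometric_two, ← tsum_mul_right]
  refine (summable_weightedModulus hψ ha).tsum_le_tsum (fun n => ?_)
    (summable_geometric_two.mul_right _)
  gcongr
  exact (modulus_le_norm _ ha).trans (mul_le_mul_of_nonneg_right (hψ n) (norm_nonneg _))

lemma modulus_le_weightedModulus (hψ : ∀ n, ‖ψ n‖ ≤ M) {a : C(K, ℝ)} (ha : 0 ≤ a) (n : ℕ) :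
    modulus (ψ n) a ≤ 2 ^ n * weightedModulus ψ a := by
  have h := (summable_weightedModulus hψ ha).le_tsum n
    fun j _ => mul_nonneg (by positivity) (modulus_nonneg _ ha)
  calc modulus (ψ n) a = 2 ^ n * ((1 / 2 : ℝ) ^ n * modulus (ψ n) a) := by
        rw [← mul_assoc, ← mul_pow]; norm_num
    _ ≤ _ := by gcongr; exact h

end WeightedModulus

lemma modulus_clopenSup_partialSups_le {K : Type*} [TopologicalSpace K] [CompactSpace K]
    [ExtremallyDisconnected K] {ψ : C(K, ℝ) →L[ℝ] ℝ}
    (hψ : ∀ V : ℕ → TopologicalSpace.Clopens K, Monotone V → ∀ b,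
      Tendsto (fun k => ψ (b * clopenIndicator (V k))) atTop
        (𝓝 (ψ (b * clopenIndicator (clopenSup V)))))
    (U : ℕ → TopologicalSpace.Clopens K) {u : ℕ → ℝ}
    (hu : ∀ j, modulus ψ (clopenIndicator (U j)) ≤ u j) (hs : Summable u) :
    modulus ψ (clopenIndicator (clopenSup (partialSups U))) ≤ ∑' j, u j := by
  have hu0 : ∀ j, 0 ≤ u j := fun j => (modulus_nonneg _ (clopenIndicator_nonneg _)).trans (hu j)
  have hfin : ∀ k, modulus ψ (clopenIndicator (partialSups U k)) ≤
      ∑ j ∈ Finset.range (k + 1), u j := by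
    intro k
    induction k with
    | zero => simpa using hu 0
    | succ k ih =>
      rw [Finset.sum_range_succ, partialSups_add_one]
      calc _ ≤ modulus ψ (clopenIndicator (partialSups U k) + clopenIndicator (U (k + 1))) :=
            modulus_mono _ (clopenIndicator_nonneg _) (clopenIndicator_sup_le _ _)
        _ ≤ _ := by
            rw [modulus_add _ (clopenIndicator_nonneg _) (clopenIndicator_nonneg _)]
            exact add_le_add ih (hu _)
  refine modulus_le _ (clopenIndicator_nonneg _) fun b hb => ?_
  have hbW : b * clopenIndicator (clopenSup (partialSups U)) = b := by
    ext x
    have hx' := ContinuousMap.le_def.1 hb x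
    by_cases hx : x ∈ clopenSup (partialSups U)
    · simp [clopenIndicator_of_mem hx]
    · have h0 : |b x| ≤ 0 := by rw [clopenIndicator_of_notMem hx] at hx'; exact hx'
      simp [abs_nonpos_iff.1 h0]
  have hlim := hψ _ (partialSups U).monotone b
  rw [hbW] at hlim
  refine le_of_tendsto' hlim fun k => ?_
  refine (le_modulus ψ (a := clopenIndicator (partialSups U k)) ?_).trans
    ((hfin k).trans (hs.sum_le_tsum _ fun j _ => hu0 j))
  refine ContinuousMap.le_def.2 fun x => ?_
  change |b x * _| ≤ _
  have hx' : |b x| ≤ _ := ContinuousMap.le_def.1 hb x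
  by_cases hx : x ∈ partialSups U k
  · rw [clopenIndicator_of_mem (le_clopenSup (partialSups U) k hx)] at hx'
    simpa [clopenIndicator_of_mem hx] using hx'
  · simp [clopenIndicator_of_notMem hx]

section CyclicMap

variable {K X Y : Type*} [TopologicalSpace K] [CompactSpace K] [T2Space K]
  [ExtremallyDisconnected K]
  [NormedAddCommGroup X] [NormedSpace ℝ X] [CompleteSpace X]
  [NormedAddCommGroup Y] [NormedSpace ℝ Y]
  {m : C(K, ℝ) →ₐ[ℝ] (X →L[ℝ] X)}

/-- A bounded operator restricted to a cyclic subspace of a Bade complete module is absolutely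
continuous with respect to a weighted modulus of a separating sequence of functionals. -/
lemma BadeComplete.exists_norm_lt_of_weightedModulus_lt (hm : ∀ a : C(K, ℝ), ‖m a‖ = ‖a‖)
    (hBade : BadeComplete m) (P : X →L[ℝ] Y) (g : X) (φ : ℕ → Y →L[ℝ] ℝ)
    (hsep : ∀ y, (∀ n, φ n y = 0) → y = 0) (S : C(K, ℝ) →L[ℝ] Y) (hS : ∀ f, S f = P (m f g))
    {M : ℝ} (hM : ∀ n, ‖(φ n).comp S‖ ≤ M) {ε : ℝ} (hε : 0 < ε) :
    ∃ δ > 0, ∀ a : C(K, ℝ), ‖a‖ ≤ 2 →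
      weightedModulus (fun n => (φ n).comp S) (a * a) < δ → ‖S a‖ < ε := by
  by_contra! hcon
  have hcon' := fun k : ℕ => hcon ((1 / 2 : ℝ) ^ k) (by positivity)
  choose a ha2 haQ haS using hcon'
  set η : ℝ := ε / (2 * (‖S‖ + 1)) with hη
  have hη0 : 0 < η := by positivity
  set U : ℕ → TopologicalSpace.Clopens K := fun k =>
    ⟨closure {x | η < |a k x|}, isClosed_closure, ExtremallyDisconnected.open_closure _
      (isOpen_lt continuous_const (a k).continuous.abs)⟩ with hU
  have hUle : ∀ k x, x ∈ U k → η ≤ |a k x| := fun k x hx =>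
    closure_minimal (t := {x | η ≤ |a k x|}) (fun y (hy : η < |a k y|) => hy.le)
      (isClosed_le continuous_const (a k).continuous.abs) hx
  have hUnot : ∀ k x, x ∉ U k → |a k x| ≤ η := fun k x hx => by
    by_contra! h
    exact hx (subset_closure h)
  have hsq : ∀ k, 0 ≤ a k * a k := fun k => ContinuousMap.le_def.2 fun x => mul_self_nonneg _
  have hUmod : ∀ n k, modulus ((φ n).comp S) (clopenIndicator (U k)) ≤
      2 ^ n / η ^ 2 * (1 / 2 : ℝ) ^ k := by
    intro n k
    have h1 := mul_modulus_le ((φ n).comp S) (clopenIndicator_nonneg (U k)) (pow_pos hη0 2)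
    have h2 : η ^ 2 • clopenIndicator (U k) ≤ a k * a k := ContinuousMap.le_def.2 fun x => by
      change η ^ 2 * _ ≤ a k x * a k x
      by_cases hx : x ∈ U k
      · rw [clopenIndicator_of_mem hx, ← abs_mul_abs_self (a k x)]
        nlinarith [hUle k x hx]
      · rw [clopenIndicator_of_notMem hx, mul_zero]
        exact mul_self_nonneg _
    have h3 := modulus_mono ((φ n).comp S)
      (smul_nonneg (pow_pos hη0 2).le (clopenIndicator_nonneg (U k))) h2
    have h4 := modulus_le_weightedModulus hM (hsq k) n
    have h5 : (2 : ℝ) ^ n * weightedModulus (fun n => (φ n).comp S) (a k * a k) ≤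
        2 ^ n * (1 / 2) ^ k := by gcongr; exact (haQ k).le
    rw [div_mul_eq_mul_div, le_div_iff₀ (pow_pos hη0 2), mul_comm]
    exact h1.trans (h3.trans (h4.trans h5))
  have hψ : ∀ n, ∀ V : ℕ → TopologicalSpace.Clopens K, Monotone V → ∀ b,
      Tendsto (fun k => ((φ n).comp S) (b * clopenIndicator (V k))) atTop
        (𝓝 (((φ n).comp S) (b * clopenIndicator (clopenSup V)))) := by
    intro n V hV b
    have h := (((φ n).comp (P.comp (m b))).continuous.tendsto _).comp
      (hBade.tendsto_clopenIndicator hV g)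
    simpa [hS, Function.comp_def] using h
  set W : ℕ → TopologicalSpace.Clopens K := fun k =>
    clopenSup (partialSups fun j => U (j + k)) with hW
  have hUW : ∀ k, U k ≤ W k := fun k => by
    have h1 := le_partialSups (fun j => U (j + k)) 0
    simp only [Nat.zero_add] at h1
    exact h1.trans (le_clopenSup (partialSups fun j => U (j + k)) 0)
  have hWanti : Antitone W := antitone_nat_of_succ_le fun k => by
    refine clopenSup_le fun j => partialSups_le _ _ _ fun i _ => ?_
    have h1 := le_partialSups (fun j => U (j + k)) (i + 1)
    have h2 : i + 1 + k = i + (k + 1) := by ring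
    simp only [h2] at h1
    exact h1.trans (le_clopenSup (partialSups fun j => U (j + k)) (i + 1))
  have hWmod : ∀ n k, modulus ((φ n).comp S) (clopenIndicator (W k)) ≤
      2 * (2 ^ n / η ^ 2) * (1 / 2 : ℝ) ^ k := by
    intro n k
    have h := modulus_clopenSup_partialSups_le (hψ n) (fun j => U (j + k))
      (u := fun j => (1 / 2 : ℝ) ^ j * (2 ^ n / η ^ 2 * (1 / 2 : ℝ) ^ k))
      (fun j => (hUmod n (j + k)).trans_eq (by rw [pow_add]; ring))
      (summable_geometric_two.mul_right _)
    rw [tsum_mul_right, tsum_geometric_two] at h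
    exact h.trans_eq (by ring)
  set E : TopologicalSpace.Clopens K := (clopenSup fun k => (W k)ᶜ)ᶜ with hE
  have hEW : ∀ k, E ≤ W k := fun k =>
    compl_le_of_compl_le (le_clopenSup (fun k => (W k)ᶜ) k)
  have hEmod : ∀ n, modulus ((φ n).comp S) (clopenIndicator E) = 0 := by
    intro n
    refine le_antisymm ?_ (modulus_nonneg _ (clopenIndicator_nonneg _))
    have hlim : Tendsto (fun k : ℕ => 2 * (2 ^ n / η ^ 2) * (1 / 2 : ℝ) ^ k) atTop (𝓝 0) := by
      simpa using (tendsto_pow_atTop_nhds_zero_of_lt_one (r := (1 / 2 : ℝ)) (by norm_num)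
        (by norm_num)).const_mul (2 * (2 ^ n / η ^ 2))
    exact ge_of_tendsto' hlim fun k =>
      (modulus_mono _ (clopenIndicator_nonneg _) (clopenIndicator_mono (hEW k))).trans (hWmod n k)
  have hWE : Tendsto (fun k => m (clopenIndicator (W k) - clopenIndicator E) g) atTop (𝓝 0) := by
    have h := hBade.tendsto_clopenIndicator (V := fun k => (W k)ᶜ)
      (fun _ _ h => compl_le_compl (hWanti h)) g
    have h2 := h.const_sub (m (clopenIndicator (clopenSup fun k => (W k)ᶜ)) g)
    rw [sub_self] at h2
    refine h2.congr fun k => ?_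
    have h3 : clopenIndicator (W k) - clopenIndicator E =
        clopenIndicator (clopenSup fun k => (W k)ᶜ) - clopenIndicator (W k)ᶜ := by
      rw [hE, clopenIndicator_compl, clopenIndicator_compl]
      ring
    rw [h3, map_sub]
    rfl
  have hSE : ∀ b : C(K, ℝ), |b| ≤ clopenIndicator E + clopenIndicator E → S b = 0 := by
    intro b hb
    refine hsep _ fun n => ?_
    have h := abs_le_modulus ((φ n).comp S) hb
    rw [modulus_add _ (clopenIndicator_nonneg _) (clopenIndicator_nonneg _), hEmod, add_zero] at h
    exact abs_nonpos_iff.1 h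
  have habs : ∀ k x, |a k x| ≤ 2 := fun k x => ((a k).norm_coe_le_norm x).trans (ha2 k)
  have hbound : ∀ k, ‖S (a k)‖ ≤
      ‖S‖ * η + ‖P‖ * (2 * ‖m (clopenIndicator (W k) - clopenIndicator E) g‖) := by
    intro k
    set e := clopenIndicator (U k) with he
    have hdec : a k = a k * (1 - e) +
        (a k * e * (clopenIndicator (W k) - clopenIndicator E) +
          a k * e * clopenIndicator E) := by
      have h1 : e * clopenIndicator (W k) = e := clopenIndicator_mul_of_le (hUW k)
      linear_combination (-a k) * h1
    have h1 : ‖a k * (1 - e)‖ ≤ η := by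
      refine (ContinuousMap.norm_le _ hη0.le).2 fun x => ?_
      change |a k x * (1 - e x)| ≤ η
      by_cases hx : x ∈ U k
      · simp [he, clopenIndicator_of_mem hx, hη0.le]
      · simpa [he, clopenIndicator_of_notMem hx] using hUnot k x hx
    have h2 : ‖a k * e‖ ≤ 2 := by
      refine (ContinuousMap.norm_le _ two_pos.le).2 fun x => ?_
      change |a k x * e x| ≤ 2
      by_cases hx : x ∈ U k
      · simpa [he, clopenIndicator_of_mem hx] using habs k x
      · simp [he, clopenIndicator_of_notMem hx]
    have h3 : S (a k * e * clopenIndicator E) = 0 := by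
      refine hSE _ (ContinuousMap.le_def.2 fun x => ?_)
      change |a k x * e x * clopenIndicator E x| ≤ clopenIndicator E x + clopenIndicator E x
      by_cases hx : x ∈ E
      · have h4 := (a k * e).norm_coe_le_norm x
        rw [Real.norm_eq_abs, ContinuousMap.mul_apply] at h4
        rw [clopenIndicator_of_mem hx, mul_one]
        linarith
      · simp [clopenIndicator_of_notMem hx]
    conv_lhs => rw [hdec]
    rw [map_add, map_add, h3, add_zero]
    refine (norm_add_le _ _).trans (add_le_add ?_ ?_)
    · exact (S.le_opNorm _).trans (mul_le_mul_of_nonneg_left h1 (norm_nonneg _))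
    · rw [hS, map_mul, mul_apply_eq_comp]
      refine (P.le_opNorm _).trans (mul_le_mul_of_nonneg_left ?_ (norm_nonneg _))
      refine ((m (a k * e)).le_opNorm _).trans ?_
      rw [hm]
      gcongr
  have hlim : Tendsto (fun k => ‖S‖ * η +
      ‖P‖ * (2 * ‖m (clopenIndicator (W k) - clopenIndicator E) g‖)) atTop (𝓝 (‖S‖ * η)) := by
    simpa using ((hWE.norm.const_mul 2).const_mul ‖P‖).const_add (‖S‖ * η)
  have hfinal : ε ≤ ‖S‖ * η := ge_of_tendsto' hlim fun k => (haS k).trans (hbound k)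
  have h1 : (‖S‖ + 1) * η = ε / 2 := by
    rw [hη]; field_simp
  nlinarith [norm_nonneg S]

/-- A bounded operator from a Bade complete module into a Banach space with a separating sequence
of functionals maps cyclic subspaces onto separable sets. -/
lemma BadeComplete.isSeparable_range [CompleteSpace Y] (hm : ∀ a : C(K, ℝ), ‖m a‖ = ‖a‖)
    (hBade : BadeComplete m) (P : X →L[ℝ] Y) (g : X) (φ : ℕ → Y →L[ℝ] ℝ)
    (hφ : ∀ n, ‖φ n‖ ≤ 1) (hsep : ∀ y, (∀ n, φ n y = 0) → y = 0) :
    TopologicalSpace.IsSeparable (Set.range fun f : C(K, ℝ) => P (m f g)) := by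
  let mL : C(K, ℝ) →L[ℝ] (X →L[ℝ] X) :=
    m.toLinearMap.mkContinuous 1 fun a => by simp [hm]
  let S : C(K, ℝ) →L[ℝ] Y := P.comp ((ContinuousLinearMap.apply ℝ X g).comp mL)
  have hS : ∀ f, S f = P (m f g) := fun f => rfl
  have hM : ∀ n, ‖(φ n).comp S‖ ≤ ‖S‖ := fun n =>
    ((φ n).opNorm_comp_le S).trans (mul_le_of_le_one_left (norm_nonneg _) (hφ n))
  set Q : C(K, ℝ) → ℝ := fun a => weightedModulus (fun n => (φ n).comp S) (a * a) with hQ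
  have hsq : ∀ a : C(K, ℝ), 0 ≤ a * a := fun a => ContinuousMap.le_def.2 fun x => mul_self_nonneg _
  have hdouble : ∀ b : C(K, ℝ), 0 ≤ b →
      weightedModulus (fun n => (φ n).comp S) (b + b) =
        2 * weightedModulus (fun n => (φ n).comp S) b := fun b hb => by
    rw [weightedModulus_add hM hb hb]; ring
  have hQpar : ∀ x y, Q (x + y) + Q (x - y) = 2 * Q x + 2 * Q y := by
    intro x y
    simp only [hQ]
    rw [← weightedModulus_add hM (hsq _) (hsq _), ← hdouble _ (hsq x), ← hdouble _ (hsq y),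
      ← weightedModulus_add hM (add_nonneg (hsq x) (hsq x)) (add_nonneg (hsq y) (hsq y))]
    congr 1
    ring
  have hQ4 : ∀ x, Q (x + x) = 4 * Q x := by
    intro x
    have h : (x + x) * (x + x) = (x * x + x * x) + (x * x + x * x) := by ring
    simp only [hQ]
    rw [h, hdouble _ (add_nonneg (hsq x) (hsq x)), hdouble _ (hsq x)]
    ring
  let c : C(K, ℝ) → ℕ → ℝ := fun f n => φ n (S f)
  obtain ⟨t, htB, htc, ht⟩ := (TopologicalSpace.IsSeparable.of_separableSpace
    (c '' Metric.closedBall 0 1)).exists_countable_dense_subset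
  choose p hpB hpc using htB
  set D : Set C(K, ℝ) := Set.range fun y : t => p y.2 with hD
  have htc' : Countable t := htc
  have hball : ∀ f : C(K, ℝ), ‖f‖ ≤ 1 → S f ∈ closure (Submodule.span ℝ (S '' D) : Set Y) := by
    intro f hf
    obtain ⟨u, hut, hu⟩ := mem_closure_iff_seq_limit.1
      (ht ⟨f, mem_closedBall_zero_iff.2 hf, rfl⟩ : c f ∈ closure t)
    set d : ℕ → C(K, ℝ) := fun k => p (hut k) with hd
    have hdlim : ∀ n, Tendsto (fun k => φ n (S (d k))) atTop (𝓝 (φ n (S f))) := fun n => by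
      refine (tendsto_pi_nhds.1 hu n).congr fun k => ?_
      rw [← hpc (hut k)]
    have hdB : ∀ k, d k ∈ Metric.closedBall (0 : C(K, ℝ)) 1 := fun k => hpB (hut k)
    obtain ⟨a, had, haQ⟩ := exists_convexHull_cauchy Q (fun x => weightedModulus_nonneg (hsq x))
      hQ4 hQpar d (2 * (‖S‖ * 1)) fun k => by
        refine (weightedModulus_le hM (hsq _)).trans ?_
        have h1 : ‖d k‖ ≤ 1 := mem_closedBall_zero_iff.1 (hdB k)
        gcongr
        exact (norm_mul_le _ _).trans (mul_le_one₀ h1 (norm_nonneg _) h1)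
    have haB : ∀ k, ‖a k‖ ≤ 1 := fun k => mem_closedBall_zero_iff.1
      (convexHull_min (by rintro _ ⟨j, -, rfl⟩; exact hdB j) (convex_closedBall _ _) (had k))
    have hcauchy : CauchySeq fun k => S (a k) := by
      refine Metric.cauchySeq_iff.2 fun ε hε => ?_
      obtain ⟨δ, hδ, hδS⟩ :=
        hBade.exists_norm_lt_of_weightedModulus_lt hm P g φ hsep S hS hM hε
      obtain ⟨N, hN⟩ := haQ δ hδ
      refine ⟨N, fun k hk l hl => ?_⟩
      rw [dist_eq_norm, ← map_sub]
      refine hδS _ ((norm_sub_le _ _).trans ?_) (hN k hk l hl)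
      linarith [haB k, haB l]
    obtain ⟨y, hy⟩ := cauchySeq_tendsto_of_complete hcauchy
    have hyS : y = S f := by
      refine sub_eq_zero.1 (hsep _ fun n => ?_)
      rw [map_sub, sub_eq_zero]
      refine tendsto_nhds_unique (((φ n).continuous.tendsto y).comp hy) ?_
      refine Metric.tendsto_atTop.2 fun ε hε => ?_
      obtain ⟨N, hN⟩ := Metric.tendsto_atTop.1 (hdlim n) ε hε
      refine ⟨N, fun k hk => ?_⟩
      have hconv : Convex ℝ (((φ n).comp S) ⁻¹' Metric.ball (φ n (S f)) ε) :=
        (convex_ball _ _).is_linear_preimage ((φ n).comp S).isLinear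
      refine convexHull_min ?_ hconv (had k)
      rintro _ ⟨j, hj, rfl⟩
      exact hN j (le_trans hk hj)
    rw [← hyS]
    refine mem_closure_of_tendsto hy (Eventually.of_forall fun k => ?_)
    have hspan : convexHull ℝ (d '' Set.Ici k) ⊆ Submodule.span ℝ D := by
      refine convexHull_min ?_ (Submodule.convex _)
      rintro _ ⟨j, -, rfl⟩
      exact Submodule.subset_span ⟨⟨u j, hut j⟩, rfl⟩
    have h := Submodule.mem_map_of_mem (f := S.toLinearMap) (hspan (had k))
    rwa [Submodule.map_span] at h
  have hsepar : TopologicalSpace.IsSeparable (closure (Submodule.span ℝ (S '' D) : Set Y)) :=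
    (((Set.countable_range _).image S).isSeparable.span (R := ℝ)).closure
  refine hsepar.mono ?_
  rintro _ ⟨f, rfl⟩
  have h1 := hball ((‖f‖ + 1)⁻¹ • f) (by
    rw [norm_smul, norm_inv, Real.norm_of_nonneg (by positivity)]
    exact inv_mul_le_one_of_le₀ (by linarith) (by positivity))
  rw [map_smul] at h1
  have h2 := (Submodule.span ℝ (S '' D)).topologicalClosure.smul_mem (‖f‖ + 1) h1
  rwa [smul_inv_smul₀ (by positivity)] at h2

end CyclicMap
section Linfty

/-- Injectivity of `ℓ∞`: an isomorphic embedding of `ℓ∞` has a bounded left inverse. -/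
lemma exists_leftInverse_of_linfty {X : Type*} [NormedAddCommGroup X] [NormedSpace ℝ X]
    (T : lp (fun _ : ℕ => ℝ) ⊤ →L[ℝ] X) {c : ℝ} (hc : 0 < c)
    (hT : ∀ f : lp (fun _ : ℕ => ℝ) ⊤, c * ‖f‖ ≤ ‖T f‖) :
    ∃ P : X →L[ℝ] lp (fun _ : ℕ => ℝ) ⊤, ∀ f, P (T f) = f := by
  have hinj : Function.Injective T.toLinearMap := by
    refine (injective_iff_map_eq_zero _).2 fun f hf => ?_
    have h := hT f
    rw [show T f = 0 from hf, norm_zero] at h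
    exact norm_le_zero_iff.1 (nonpos_of_mul_nonpos_right h hc)
  let e := LinearEquiv.ofInjective T.toLinearMap hinj
  have he : ∀ x, ‖e.symm x‖ ≤ c⁻¹ * ‖x‖ := fun x => by
    have h := hT (e.symm x)
    have h2 : T (e.symm x) = x := congrArg Subtype.val (e.apply_symm_apply x)
    rw [h2] at h
    rw [inv_mul_eq_div, le_div_iff₀ hc, mul_comm]
    exact h
  let eL := e.symm.toLinearMap.mkContinuous c⁻¹ he
  have hext : ∀ n : ℕ, ∃ ψ : X →L[ℝ] ℝ, (∀ f, ψ (T f) = f n) ∧ ‖ψ‖ ≤ c⁻¹ := by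
    intro n
    obtain ⟨ψ, hψ, hψn⟩ := exists_extension_norm_eq (LinearMap.range T.toLinearMap)
      ((lp.evalCLM ℝ (fun _ : ℕ => ℝ) ⊤ n).comp eL)
    refine ⟨ψ, fun f => ?_, ?_⟩
    · have h := hψ (e f)
      have h2 : eL (e f) = f := e.symm_apply_apply f
      rw [ContinuousLinearMap.comp_apply, h2] at h
      exact h
    · rw [hψn]
      refine ContinuousLinearMap.opNorm_le_bound _ (inv_nonneg.2 hc.le) fun x => ?_
      exact (lp.norm_apply_le_norm ENNReal.top_ne_zero (eL x) n).trans (he x)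
  choose ψ hψT hψn using hext
  have hb : ∀ x n, ‖ψ n x‖ ≤ c⁻¹ * ‖x‖ := fun x n => (ψ n).le_of_opNorm_le (hψn n) x
  let PL : X →ₗ[ℝ] lp (fun _ : ℕ => ℝ) ⊤ :=
    { toFun := fun x => ⟨fun n => ψ n x, memℓp_infty ⟨c⁻¹ * ‖x‖, by
        rintro _ ⟨n, rfl⟩; exact hb x n⟩⟩
      map_add' := fun x y => lp.ext (funext fun n => map_add (ψ n) x y)
      map_smul' := fun r x => lp.ext (funext fun n => map_smul (ψ n) r x) }
  exact ⟨PL.mkContinuous c⁻¹ fun x => lp.norm_le_of_forall_le (by positivity) (hb x),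
    fun f => lp.ext (funext fun n => hψT n f)⟩

lemma not_isSeparable_univ_linfty :
    ¬ TopologicalSpace.IsSeparable (Set.univ : Set (lp (fun _ : ℕ => ℝ) ⊤)) := by
  rintro ⟨t, htc, ht⟩
  obtain ⟨d, hd⟩ := (htc.union (Set.countable_singleton 0)).exists_eq_range
    ⟨0, Or.inr rfl⟩
  let s : ℕ → ℝ := fun n => if 0 < d n n then -1 else 1
  have hs : ∀ n, ‖s n‖ ≤ 1 := fun n => by
    simp only [s]; split_ifs <;> simp
  let f : lp (fun _ : ℕ => ℝ) ⊤ := ⟨s, memℓp_infty ⟨1, by rintro _ ⟨n, rfl⟩; exact hs n⟩⟩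
  obtain ⟨y, hy, hfy⟩ := Metric.mem_closure_iff.1 (ht (Set.mem_univ f)) 1 one_pos
  obtain ⟨n, rfl⟩ : y ∈ Set.range d := hd ▸ Or.inl hy
  rw [dist_eq_norm] at hfy
  have h := (lp.norm_apply_le_norm ENNReal.top_ne_zero (f - d n) n).trans_lt hfy
  change ‖s n - d n n‖ < 1 at h
  rw [Real.norm_eq_abs, abs_lt] at h
  simp only [s] at h
  split_ifs at h <;> linarith

end Linfty

/-- For a finitely generated module over a hyperstonian `K` with `m` injective,
`m(C(K))` weak-operator closed, `m` (weak-star, weak-operator) continuous and the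
idempotents Bade complete: if no cyclic subspace of `X` contains a copy of `ℓ∞`, then
`X` contains no copy of `ℓ∞`. -/
theorem stmt18 {K X : Type*} [TopologicalSpace K] [CompactSpace K] [T2Space K]
    [ExtremallyDisconnected K]
    [NormedAddCommGroup X] [NormedSpace ℝ X] [CompleteSpace X]
    (m : C(K, ℝ) →ₐ[ℝ] (X →L[ℝ] X))
    (hm : ∀ a : C(K, ℝ), ‖m a‖ = ‖a‖)
    (hinj : Function.Injective m)
    (hclosed : ∀ T : X →L[ℝ] X,
      (∀ ε > (0 : ℝ), ∀ s : Finset (X × (X →L[ℝ] ℝ)), ∃ a : C(K, ℝ),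
        ∀ p ∈ s, |p.2 (m a p.1) - p.2 (T p.1)| < ε) → T ∈ Set.range m)
    (hsep : SeparatesByNormalFunctionals K)
    (hcont : WStarWOTContinuous m)
    (hBade : BadeComplete m)
    (n : ℕ) (g : Fin n → X)
    (hgen : closure (↑(Submodule.span ℝ
      (⋃ i : Fin n, Set.range fun a : C(K, ℝ) => m a (g i))) : Set X) = Set.univ)
    (hcycl : ∀ x : X, ¬ ∃ T : lp (fun _ : ℕ => ℝ) ⊤ →L[ℝ] X,
      (∃ c > (0 : ℝ), ∀ f : lp (fun _ : ℕ => ℝ) ⊤, c * ‖f‖ ≤ ‖T f‖) ∧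
      ∀ f : lp (fun _ : ℕ => ℝ) ⊤,
        T f ∈ closure (Set.range fun a : C(K, ℝ) => m a x)) :
    ¬ ContainsLinfty X := by
  rintro ⟨T, c, hc, hT⟩
  obtain ⟨P, hP⟩ := exists_leftInverse_of_linfty T hc hT
  refine not_isSeparable_univ_linfty ?_
  set A : Set X := ⋃ i : Fin n, Set.range fun a : C(K, ℝ) => m a (g i) with hA
  have hsepar : TopologicalSpace.IsSeparable (P '' A) := by
    rw [hA, Set.image_iUnion]
    refine TopologicalSpace.IsSeparable.iUnion fun i => ?_
    rw [← Set.range_comp]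
    refine hBade.isSeparable_range hm P (g i) (fun k => lp.evalCLM ℝ (fun _ : ℕ => ℝ) ⊤ k)
      (fun k => ContinuousLinearMap.opNorm_le_bound _ zero_le_one fun y => ?_)
      fun y hy => lp.ext (funext hy)
    rw [one_mul]
    exact lp.norm_apply_le_norm ENNReal.top_ne_zero y k
  refine (hsepar.span (R := ℝ)).closure.mono fun y _ => ?_
  have h1 : T y ∈ closure (Submodule.span ℝ A : Set X) := hgen ▸ Set.mem_univ _
  have h2 := image_closure_subset_closure_image P.continuous ⟨T y, h1, rfl⟩
  rw [hP] at h2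
  refine closure_mono ?_ h2
  rintro _ ⟨x, hx, rfl⟩
  have h := Submodule.mem_map_of_mem (f := P.toLinearMap) hx
  rwa [Submodule.map_span] at h
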